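/- arXiv:quant-ph/0108023 — 4 statements merged into one kernel-verified Lean document; each statement's English description precedes it below -/
import Mathlib

section
/- Let (Ω, 𝒜, μ) be a probability space and let A, B ∈ 𝒜 satisfy μ(A ∩ B) > μ(A)μ(B), μ(A ∩ Bᶜ) > 0 and μ(Aᶜ ∩ B) > 0. Set r := (μ(A ∩ B) − μ(A)μ(B)) / (1 − μ(A ∪ B)). If C ∈ 𝒜 satisfies C ⊆ A ∩ B and μ(C) = r, then 0 < μ(C) < 1 and C satisfies the Reichenbach common cause conditions for (A, B): μ(A∩B∩C)/μ(C) = (μ(A∩C)/μ(C))·(μ(B∩C)/μ(C)); μ(A∩B∩Cᶜ)/μ(Cᶜ) = (μ(A∩Cᶜ)/μ(Cᶜ))·(μ(B∩Cᶜ)/μ(Cᶜ)); μ(A∩C)/μ(C) > μ(A∩Cᶜ)/μ(Cᶜ); and μ(B∩C)/μ(C) > μ(B∩Cᶜ)/μ(Cᶜ). -/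
open MeasureTheory

/-- If `A`, `B` are positively correlated events in a probability space with
`μ(A ∩ Bᶜ) > 0` and `μ(Aᶜ ∩ B) > 0`, and `C ⊆ A ∩ B` has measure
`(μ(A ∩ B) − μ(A)μ(B)) / (1 − μ(A ∪ B))`, then `0 < μ(C) < 1` and `C` satisfies the
Reichenbach common cause conditions for `(A, B)`. -/
theorem stmt0 {Ω : Type*} [MeasurableSpace Ω] (μ : Measure Ω) [IsProbabilityMeasure μ]
    (A B C : Set Ω) (hA : MeasurableSet A) (hB : MeasurableSet B) (hC : MeasurableSet C)
    (hcorr : (μ (A ∩ B)).toReal > (μ A).toReal * (μ B).toReal)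
    (hABc : (μ (A ∩ Bᶜ)).toReal > 0)
    (hAcB : (μ (Aᶜ ∩ B)).toReal > 0)
    (hCsub : C ⊆ A ∩ B)
    (hCval : (μ C).toReal =
      ((μ (A ∩ B)).toReal - (μ A).toReal * (μ B).toReal) / (1 - (μ (A ∪ B)).toReal)) :
    0 < (μ C).toReal ∧ (μ C).toReal < 1 ∧
    (μ (A ∩ B ∩ C)).toReal / (μ C).toReal =
      ((μ (A ∩ C)).toReal / (μ C).toReal) * ((μ (B ∩ C)).toReal / (μ C).toReal) ∧
    (μ (A ∩ B ∩ Cᶜ)).toReal / (μ Cᶜ).toReal =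
      ((μ (A ∩ Cᶜ)).toReal / (μ Cᶜ).toReal) * ((μ (B ∩ Cᶜ)).toReal / (μ Cᶜ).toReal) ∧
    (μ (A ∩ C)).toReal / (μ C).toReal > (μ (A ∩ Cᶜ)).toReal / (μ Cᶜ).toReal ∧
    (μ (B ∩ C)).toReal / (μ C).toReal > (μ (B ∩ Cᶜ)).toReal / (μ Cᶜ).toReal := by
  change 0 < μ.real C ∧ μ.real C < 1 ∧
    μ.real (A ∩ B ∩ C) / μ.real C = μ.real (A ∩ C) / μ.real C * (μ.real (B ∩ C) / μ.real C) ∧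
    μ.real (A ∩ B ∩ Cᶜ) / μ.real Cᶜ =
      μ.real (A ∩ Cᶜ) / μ.real Cᶜ * (μ.real (B ∩ Cᶜ) / μ.real Cᶜ) ∧
    μ.real (A ∩ C) / μ.real C > μ.real (A ∩ Cᶜ) / μ.real Cᶜ ∧
    μ.real (B ∩ C) / μ.real C > μ.real (B ∩ Cᶜ) / μ.real Cᶜ
  change μ.real (A ∩ B) > μ.real A * μ.real B at hcorr
  change μ.real (A ∩ Bᶜ) > 0 at hABc
  change μ.real (Aᶜ ∩ B) > 0 at hAcB
  change μ.real C = (μ.real (A ∩ B) - μ.real A * μ.real B) / (1 - μ.real (A ∪ B)) at hCval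
  have hCA : C ⊆ A := hCsub.trans Set.inter_subset_left
  have hCB : C ⊆ B := hCsub.trans Set.inter_subset_right
  have real_inter_compl {S : Set Ω} (h : C ⊆ S) : μ.real (S ∩ Cᶜ) = μ.real S - μ.real C := by
    rw [← Set.sdiff_eq, measureReal_sdiff h hC]
  have hA_eq : μ.real A = μ.real (A ∩ B) + μ.real (A ∩ Bᶜ) := by
    rw [← Set.sdiff_eq, measureReal_inter_add_sdiff hB]
  have hB_eq : μ.real B = μ.real (A ∩ B) + μ.real (Aᶜ ∩ B) := by
    rw [Set.inter_comm A, Set.inter_comm Aᶜ, ← Set.sdiff_eq, measureReal_inter_add_sdiff hA]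
  have h_union : μ.real (A ∪ B) + μ.real (A ∩ B) = μ.real A + μ.real B :=
    measureReal_union_add_inter hB
  have h_union_le : μ.real (A ∪ B) ≤ 1 := measureReal_le_one
  rw [real_inter_compl hCsub, real_inter_compl hCA, real_inter_compl hCB,
    Set.inter_eq_right.mpr hCsub, Set.inter_eq_right.mpr hCA, Set.inter_eq_right.mpr hCB,
    probReal_compl_eq_one_sub hC]
  have hp : 0 ≤ μ.real (A ∩ B) := measureReal_nonneg
  generalize μ.real (A ∩ B) = p at *
  generalize μ.real (A ∩ Bᶜ) = x at *
  generalize μ.real (Aᶜ ∩ B) = y at *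
  generalize μ.real (A ∪ B) = u at *
  generalize μ.real C = r at *
  generalize μ.real A = a at *
  generalize μ.real B = b at *
  subst hA_eq hB_eq
  obtain rfl : u = p + x + y := by linarith
  have hxy : 0 < x * y := mul_pos hABc hAcB
  have hq : 0 < 1 - (p + x + y) := by
    refine lt_of_le_of_ne (by linarith) fun h => ?_
    have h_mul : p * (1 - (p + x + y)) = 0 := by rw [← h, mul_zero]
    nlinarith
  have hr : 0 < r := hCval ▸ div_pos (by linarith) hq
  have hrq : r * (1 - (p + x + y)) = p - (p + x) * (p + y) := by
    rw [hCval, div_mul_cancel₀ _ hq.ne']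
  have hrp : r < p := by
    by_contra! h
    nlinarith
  have hr1 : 0 < 1 - r := by linarith
  refine ⟨hr, by linarith, by simp [hr.ne'], ?_, ?_, ?_⟩
  · field_simp
    linarith
  · rw [div_self hr.ne', gt_iff_lt, div_lt_one hr1]
    linarith
  · rw [div_self hr.ne', gt_iff_lt, div_lt_one hr1]
    linarith
end

section
/- On ℝ⁴ with the Minkowski form η(x) = x₀² − x₁² − x₂² − x₃², let y, x ∈ ℝ⁴ satisfy η(x − y) > 0 and x₀ > y₀, and let D := I⁺(y) ∩ I⁻(x) be the corresponding double cone. Then the causal completion of D equals D, i.e. D'' = D. -/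
/-- The Minkowski form on `ℝ⁴`. -/
def minkowskiForm (x : Fin 4 → ℝ) : ℝ := x 0 ^ 2 - x 1 ^ 2 - x 2 ^ 2 - x 3 ^ 2

/-- The causal complement of a set `S ⊆ ℝ⁴`: the interior of the set of points that are
spacelike separated from every point of `S`. -/
def causalComplement (S : Set (Fin 4 → ℝ)) : Set (Fin 4 → ℝ) :=
  interior {z | ∀ v ∈ S, minkowskiForm (z - v) < 0}

/-- The open forward light cone with apex `y`. -/
def forwardCone (y : Fin 4 → ℝ) : Set (Fin 4 → ℝ) :=
  {z | minkowskiForm (z - y) > 0 ∧ z 0 > y 0}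

/-- The open backward light cone with apex `x`. -/
def backwardCone (x : Fin 4 → ℝ) : Set (Fin 4 → ℝ) :=
  {z | minkowskiForm (x - z) > 0 ∧ z 0 < x 0}

/-- The symmetric bilinear form polarizing `minkowskiForm`. -/
def minkowskiBilin (a b : Fin 4 → ℝ) : ℝ := a 0 * b 0 - a 1 * b 1 - a 2 * b 2 - a 3 * b 3

theorem minkowskiForm_neg (a : Fin 4 → ℝ) : minkowskiForm (-a) = minkowskiForm a := by
  simp [minkowskiForm]

theorem minkowskiForm_sub_comm (a b : Fin 4 → ℝ) :
    minkowskiForm (a - b) = minkowskiForm (b - a) := by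
  rw [← minkowskiForm_neg, neg_sub]

theorem minkowskiForm_add (a b : Fin 4 → ℝ) :
    minkowskiForm (a + b) = minkowskiForm a + 2 * minkowskiBilin a b + minkowskiForm b := by
  simp only [minkowskiForm, minkowskiBilin, Pi.add_apply]
  ring

@[fun_prop]
theorem continuous_minkowskiForm : Continuous minkowskiForm := by
  unfold minkowskiForm
  fun_prop

/-- Future-directed causal vectors have nonnegative Minkowski product. -/
theorem minkowskiBilin_nonneg {a b : Fin 4 → ℝ} (ha : 0 ≤ minkowskiForm a) (ha0 : 0 ≤ a 0)
    (hb : 0 ≤ minkowskiForm b) (hb0 : 0 ≤ b 0) : 0 ≤ minkowskiBilin a b := by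
  unfold minkowskiForm at ha hb
  have cauchy_schwarz : (a 1 * b 1 + a 2 * b 2 + a 3 * b 3) ^ 2 ≤
      (a 1 ^ 2 + a 2 ^ 2 + a 3 ^ 2) * (b 1 ^ 2 + b 2 ^ 2 + b 3 ^ 2) := by
    nlinarith [sq_nonneg (a 1 * b 2 - a 2 * b 1), sq_nonneg (a 1 * b 3 - a 3 * b 1),
      sq_nonneg (a 2 * b 3 - a 3 * b 2)]
  have causal_le : (a 1 ^ 2 + a 2 ^ 2 + a 3 ^ 2) * (b 1 ^ 2 + b 2 ^ 2 + b 3 ^ 2) ≤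
      a 0 ^ 2 * b 0 ^ 2 :=
    mul_le_mul (by linarith) (by linarith) (by positivity) (by positivity)
  have := abs_le_of_sq_le_sq' (cauchy_schwarz.trans (causal_le.trans_eq (mul_pow _ _ 2).symm))
    (mul_nonneg ha0 hb0)
  unfold minkowskiBilin
  linarith [this.2]

/-- The sum of a future-directed timelike and a future-directed causal vector is timelike. -/
theorem minkowskiForm_add_pos {a b : Fin 4 → ℝ} (ha : 0 < minkowskiForm a) (ha0 : 0 ≤ a 0)
    (hb : 0 ≤ minkowskiForm b) (hb0 : 0 ≤ b 0) : 0 < minkowskiForm (a + b) := by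
  rw [minkowskiForm_add]
  linarith [minkowskiBilin_nonneg ha.le ha0 hb hb0]

/-- A vector that is not future-directed timelike has nonpositive product with some
future-directed null vector. -/
theorem exists_null_minkowskiBilin_nonpos {u : Fin 4 → ℝ}
    (hu : ¬(minkowskiForm u > 0 ∧ u 0 > 0)) :
    ∃ k : Fin 4 → ℝ, k 0 = 1 ∧ minkowskiForm k = 0 ∧ minkowskiBilin u k ≤ 0 := by
  set r := √(u 1 ^ 2 + u 2 ^ 2 + u 3 ^ 2)
  have hr2 : r ^ 2 = u 1 ^ 2 + u 2 ^ 2 + u 3 ^ 2 := Real.sq_sqrt (by positivity)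
  have hr0 : 0 ≤ r := Real.sqrt_nonneg _
  have hur : u 0 ≤ r := by
    by_contra! h
    refine hu ⟨?_, hr0.trans_lt h⟩
    unfold minkowskiForm
    nlinarith
  rcases hr0.eq_or_lt with h | h
  · have h1 : u 1 = 0 := by
      rw [← h] at hr2
      nlinarith [sq_nonneg (u 1), sq_nonneg (u 2), sq_nonneg (u 3)]
    refine ⟨![1, 1, 0, 0], by simp, by simp [minkowskiForm], ?_⟩
    simp [minkowskiBilin, h1]
    linarith
  · refine ⟨![1, u 1 / r, u 2 / r, u 3 / r], by simp, ?_, ?_⟩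
    · simp [minkowskiForm]
      field_simp
      linarith
    · have : minkowskiBilin u ![1, u 1 / r, u 2 / r, u 3 / r] = u 0 - r := by
        simp [minkowskiBilin]
        field_simp
        linarith
      linarith

/-- Moving far along a null direction `k` makes a vector spacelike if its product with `k` is
negative. -/
theorem eventually_minkowskiForm_add_smul_neg {a k : Fin 4 → ℝ} (hk : minkowskiForm k = 0)
    (ha : minkowskiBilin a k < 0) :
    ∀ᶠ t : ℝ in Filter.atTop, minkowskiForm (a + t • k) < 0 := by
  filter_upwards [Filter.eventually_gt_atTop (minkowskiForm a / (-2 * minkowskiBilin a k))]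
    with t ht
  rw [div_lt_iff₀ (by linarith)] at ht
  have : minkowskiForm (a + t • k) =
      minkowskiForm a + 2 * t * minkowskiBilin a k + t ^ 2 * minkowskiForm k := by
    simp only [minkowskiForm, minkowskiBilin, Pi.add_apply, Pi.smul_apply, smul_eq_mul]
    ring
  rw [this, hk]
  linarith

theorem isOpen_forwardCone (y : Fin 4 → ℝ) : IsOpen (forwardCone y) := by
  simp only [forwardCone, Set.ofPred_and, gt_iff_lt]
  exact (isOpen_lt (by fun_prop) (by fun_prop)).inter (isOpen_lt (by fun_prop) (by fun_prop))

theorem isOpen_backwardCone (x : Fin 4 → ℝ) : IsOpen (backwardCone x) := by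
  simp only [backwardCone, Set.ofPred_and, gt_iff_lt]
  exact (isOpen_lt (by fun_prop) (by fun_prop)).inter (isOpen_lt (by fun_prop) (by fun_prop))

/-- An open set is contained in its causal completion. -/
theorem IsOpen.subset_causalComplement_causalComplement {S : Set (Fin 4 → ℝ)} (hS : IsOpen S) :
    S ⊆ causalComplement (causalComplement S) := by
  refine interior_maximal (fun z hz v hv => ?_) hS
  rw [minkowskiForm_sub_comm]
  exact interior_subset hv z hz

/-- A point spacelike to both tips of a double cone lies in its causal complement. -/
theorem mem_causalComplement_doubleCone {x y v : Fin 4 → ℝ} (hy : minkowskiForm (v - y) < 0)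
    (hx : minkowskiForm (v - x) < 0) :
    v ∈ causalComplement (forwardCone y ∩ backwardCone x) := by
  have hopen : IsOpen {v : Fin 4 → ℝ | minkowskiForm (v - y) < 0 ∧ minkowskiForm (v - x) < 0} := by
    rw [Set.ofPred_and]
    exact (isOpen_lt (by fun_prop) (by fun_prop)).inter (isOpen_lt (by fun_prop) (by fun_prop))
  refine interior_maximal ?_ hopen ⟨hy, hx⟩
  rintro v ⟨hy, hx⟩ w ⟨⟨hwy, hwy0⟩, hwx, hwx0⟩
  by_contra! h
  rcases le_total (w 0) (v 0) with h0 | h0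
  · have := minkowskiForm_add_pos hwy (by simpa using hwy0.le) h (by simpa using h0)
    rw [add_comm, sub_add_sub_cancel] at this
    exact this.not_gt hy
  · rw [minkowskiForm_sub_comm] at h
    have := minkowskiForm_add_pos hwx (by simpa using hwx0.le) h (by simpa using h0)
    rw [sub_add_sub_cancel, minkowskiForm_sub_comm] at this
    exact this.not_gt hx

/-- A point from which some null ray eventually becomes spacelike to both tips of a double cone
is not spacelike to the whole causal complement of that double cone. -/
theorem exists_mem_causalComplement_doubleCone {x y z k : Fin 4 → ℝ} (hk : minkowskiForm k = 0)
    (hy : minkowskiBilin (z - y) k < 0) (hx : minkowskiBilin (z - x) k < 0) :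
    ∃ v ∈ causalComplement (forwardCone y ∩ backwardCone x), minkowskiForm (z - v) = 0 := by
  obtain ⟨t, hty, htx⟩ := ((eventually_minkowskiForm_add_smul_neg hk hy).and
    (eventually_minkowskiForm_add_smul_neg hk hx)).exists
  rw [sub_add_eq_add_sub] at hty htx
  refine ⟨z + t • k, mem_causalComplement_doubleCone hty htx, ?_⟩
  rw [minkowskiForm_sub_comm, add_sub_cancel_left]
  have : minkowskiForm (t • k) = t ^ 2 * minkowskiForm k := by
    simp only [minkowskiForm, Pi.smul_apply, smul_eq_mul]
    ring
  rw [this, hk, mul_zero]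

theorem exists_pos_add_smul_mem {S : Set (Fin 4 → ℝ)} {z : Fin 4 → ℝ} (hz : z ∈ interior S)
    (d : Fin 4 → ℝ) : ∃ ε : ℝ, 0 < ε ∧ z + ε • d ∈ S := by
  have hcont : Continuous fun ε : ℝ => z + ε • d := by fun_prop
  have h : ∀ᶠ ε : ℝ in nhds 0, z + ε • d ∈ S :=
    hcont.continuousAt.eventually_mem (by simpa using mem_interior_iff_mem_nhds.mp hz)
  exact (eventually_mem_nhdsWithin.and (h.filter_mono nhdsWithin_le_nhds)).exists
    (f := nhdsWithin 0 (Set.Ioi 0))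

/-- every double cone is causally complete, `D'' = D`. -/
theorem stmt10 (y x : Fin 4 → ℝ)
    (htimelike : minkowskiForm (x - y) > 0) (horder : x 0 > y 0) :
    causalComplement (causalComplement (forwardCone y ∩ backwardCone x)) =
      forwardCone y ∩ backwardCone x := by
  refine Set.Subset.antisymm (fun z hz => ⟨?_, ?_⟩)
    ((isOpen_forwardCone y).inter
      (isOpen_backwardCone x)).subset_causalComplement_causalComplement
  · by_contra hzy
    obtain ⟨k, hk0, hk, hzk⟩ := exists_null_minkowskiBilin_nonpos (u := z - y)
      (by simpa [forwardCone] using hzy)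
    have hxk := minkowskiBilin_nonneg htimelike.le (by simpa using horder.le) hk.ge (by simp [hk0])
    obtain ⟨ε, hε, hmem⟩ := exists_pos_add_smul_mem hz (Pi.single 0 (-1))
    obtain ⟨v, hv, hzv⟩ := exists_mem_causalComplement_doubleCone (x := x) (y := y)
      (z := z + ε • (Pi.single 0 (-1))) hk
      (by simp [minkowskiBilin, hk0] at hzk ⊢; linarith)
      (by simp [minkowskiBilin, hk0] at hzk hxk ⊢; linarith)
    exact (hmem v hv).ne hzv
  · by_contra hzx
    obtain ⟨k, hk0, hk, hzk⟩ := exists_null_minkowskiBilin_nonpos (u := x - z)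
      (by simpa [backwardCone] using hzx)
    have hxk := minkowskiBilin_nonneg htimelike.le (by simpa using horder.le) hk.ge (by simp [hk0])
    obtain ⟨ε, hε, hmem⟩ := exists_pos_add_smul_mem hz (Pi.single 0 1)
    obtain ⟨v, hv, hzv⟩ := exists_mem_causalComplement_doubleCone (x := x) (y := y)
      (z := z + ε • (Pi.single 0 1)) ((minkowskiForm_neg k).trans hk)
      (by simp [minkowskiBilin, hk0] at hzk hxk ⊢; linarith)
      (by simp [minkowskiBilin, hk0] at hzk ⊢; linarith)
    exact (hmem v hv).ne hzv
end

section
/- Let (Ω, 𝒜, μ) be a probability space such that μ has no atoms, and let A, B ∈ 𝒜 satisfy μ(A ∩ B) > μ(A)μ(B), μ(A ∩ Bᶜ) > 0 and μ(Aᶜ ∩ B) > 0. Then there exists C ∈ 𝒜 with C ⊆ A ∩ B, 0 < μ(C) < 1, satisfying the Reichenbach common cause conditions for (A, B): μ(A∩B∩C)/μ(C) = (μ(A∩C)/μ(C))·(μ(B∩C)/μ(C)); μ(A∩B∩Cᶜ)/μ(Cᶜ) = (μ(A∩Cᶜ)/μ(Cᶜ))·(μ(B∩Cᶜ)/μ(Cᶜ));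 μ(A∩C)/μ(C) > μ(A∩Cᶜ)/μ(Cᶜ); and μ(B∩C)/μ(C) > μ(B∩Cᶜ)/μ(Cᶜ). -/
open MeasureTheory

namespace MeasureTheory.Measure

open Set Filter Topology

variable {Ω : Type*} [MeasurableSpace Ω] {μ : Measure Ω} [IsFiniteMeasure μ]

/-- In an atomless finite measure, a set of positive measure has a subset of positive measure at
most half as large. -/
theorem exists_subset_measureReal_le_half
    (hμ : ∀ A : Set Ω, MeasurableSet A → 0 < μ A →
      ∃ B : Set Ω, MeasurableSet B ∧ B ⊆ A ∧ 0 < μ B ∧ μ B < μ A)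
    {S : Set Ω} (hS : MeasurableSet S) (hpos : 0 < μ.real S) :
    ∃ D, MeasurableSet D ∧ D ⊆ S ∧ 0 < μ.real D ∧ μ.real D ≤ μ.real S / 2 := by
  obtain ⟨B, hB, hBS, hB0, hBlt⟩ := hμ S hS (ENNReal.toReal_pos_iff.1 hpos).1
  have h0 : 0 < μ.real B := ENNReal.toReal_pos hB0.ne' (measure_ne_top μ B)
  have hlt : μ.real B < μ.real S :=
    (ENNReal.toReal_lt_toReal (measure_ne_top μ B) (measure_ne_top μ S)).2 hBlt
  rcases le_total (μ.real B) (μ.real S / 2) with h | h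
  · exact ⟨B, hB, hBS, h0, h⟩
  · have hdiff := measureReal_sdiff hBS hB (μ := μ)
    exact ⟨S \ B, hS.diff hB, sdiff_subset, by linarith, by linarith⟩

/-- In an atomless finite measure, a set of positive measure has subsets of arbitrarily small
positive measure. -/
theorem exists_subset_measureReal_pos_le
    (hμ : ∀ A : Set Ω, MeasurableSet A → 0 < μ A →
      ∃ B : Set Ω, MeasurableSet B ∧ B ⊆ A ∧ 0 < μ B ∧ μ B < μ A)
    {S : Set Ω} (hS : MeasurableSet S) (hpos : 0 < μ.real S) {ε : ℝ} (hε : 0 < ε) :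
    ∃ D, MeasurableSet D ∧ D ⊆ S ∧ 0 < μ.real D ∧ μ.real D ≤ ε := by
  have key (n : ℕ) : ∃ D, MeasurableSet D ∧ D ⊆ S ∧ 0 < μ.real D ∧
      μ.real D ≤ μ.real S * (1 / 2) ^ n := by
    induction n with
    | zero => exact ⟨S, hS, subset_rfl, hpos, by simp⟩
    | succ n ih =>
      obtain ⟨D, hD, hDS, hD0, hDle⟩ := ih
      obtain ⟨E, hE, hED, hE0, hEle⟩ := exists_subset_measureReal_le_half hμ hD hD0
      exact ⟨E, hE, hED.trans hDS, hE0, by rw [pow_succ]; linarith⟩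
  obtain ⟨n, hn⟩ := exists_pow_lt_of_lt_one (div_pos hε hpos) (one_half_lt_one (α := ℝ))
  obtain ⟨D, hD, hDS, hD0, hDle⟩ := key n
  refine ⟨D, hD, hDS, hD0, hDle.trans ?_⟩
  rw [lt_div_iff₀ hpos] at hn
  linarith

/-- Among the measurable subsets of `S` of measure at most `t`, some set has the measure of each
of its supersets in this family. -/
theorem exists_maximal_subset_measureReal_le (μ : Measure Ω) [IsFiniteMeasure μ]
    (S : Set Ω) {t : ℝ} (ht : 0 ≤ t) :
    ∃ C, MeasurableSet C ∧ C ⊆ S ∧ μ.real C ≤ t ∧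
      ∀ E, MeasurableSet E → E ⊆ S → μ.real E ≤ t → C ⊆ E → μ.real E ≤ μ.real C := by
  let F := {C : Set Ω // MeasurableSet C ∧ C ⊆ S ∧ μ.real C ≤ t}
  have step (C : F) : ∃ C' : F, C.1 ⊆ C'.1 ∧
      ∀ E : F, C.1 ⊆ E.1 → μ.real E.1 + μ.real C.1 ≤ 2 * μ.real C'.1 := by
    let V : Set ℝ := {r | ∃ E : F, C.1 ⊆ E.1 ∧ μ.real E.1 = r}
    have hV : V.Nonempty := ⟨_, C, subset_rfl, rfl⟩
    have hVb : BddAbove V := ⟨t, by rintro _ ⟨E, -, rfl⟩; exact E.2.2.2⟩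
    have hle (E : F) (h : C.1 ⊆ E.1) : μ.real E.1 ≤ sSup V := le_csSup hVb ⟨E, h, rfl⟩
    rcases (hle C subset_rfl).eq_or_lt with h | h
    · exact ⟨C, subset_rfl, fun E hE => by linarith [hle E hE]⟩
    · obtain ⟨_, ⟨C', hC', rfl⟩, hlt⟩ := exists_lt_of_lt_csSup hV
        (show (sSup V + μ.real C.1) / 2 < sSup V by linarith)
      exact ⟨C', hC', fun E hE => by linarith [hle E hE]⟩
  choose next hsub hnext using step
  let c : ℕ → F := Nat.rec ⟨∅, .empty, empty_subset S, by simpa⟩ (fun _ => next)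
  have hmono : Monotone fun n => (c n).1 := monotone_nat_of_le_succ fun n => hsub (c n)
  have hlim : Tendsto (fun n => μ.real (c n).1) atTop (𝓝 (μ.real (⋃ n, (c n).1))) :=
    (ENNReal.tendsto_toReal (measure_ne_top μ _)).comp (tendsto_measure_iUnion_atTop hmono)
  refine ⟨⋃ n, (c n).1, .iUnion fun n => (c n).2.1, iUnion_subset fun n => (c n).2.2.1,
    le_of_tendsto' hlim fun n => (c n).2.2.2, fun E hE hES hEt hCE => ?_⟩
  have := le_of_tendsto_of_tendsto' (hlim.const_add (μ.real E))
    ((hlim.comp (tendsto_add_atTop_nat 1)).const_mul 2)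
    fun n => hnext (c n) ⟨E, hE, hES, hEt⟩ ((subset_iUnion _ n).trans hCE)
  linarith

/-- **Sierpiński's theorem**: an atomless finite measure attains every value between `0` and the
measure of a measurable set `S` on the measurable subsets of `S`. -/
theorem exists_subset_measureReal_eq
    (hμ : ∀ A : Set Ω, MeasurableSet A → 0 < μ A →
      ∃ B : Set Ω, MeasurableSet B ∧ B ⊆ A ∧ 0 < μ B ∧ μ B < μ A)
    {S : Set Ω} (hS : MeasurableSet S) {t : ℝ} (ht : 0 ≤ t) (htS : t ≤ μ.real S) :
    ∃ C, MeasurableSet C ∧ C ⊆ S ∧ μ.real C = t := by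
  obtain ⟨C, hC, hCS, hCt, hmax⟩ := exists_maximal_subset_measureReal_le μ S ht
  refine ⟨C, hC, hCS, hCt.eq_or_lt.resolve_right fun hlt => ?_⟩
  have hdiff := measureReal_sdiff hCS hC (μ := μ)
  obtain ⟨D, hD, hDS, hD0, hDle⟩ := exists_subset_measureReal_pos_le hμ (hS.diff hC)
    (by linarith) (sub_pos.2 hlt)
  have hunion : μ.real (C ∪ D) = μ.real C + μ.real D :=
    measureReal_union (disjoint_sdiff_right.mono_right hDS) hD
  have := hmax (C ∪ D) (hC.union hD) (union_subset hCS (hDS.trans sdiff_subset))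
    (by linarith) subset_union_left
  linarith

end MeasureTheory.Measure

/-- in an atomless probability space, every pair of positively correlated
events `A, B` with `μ(A ∩ Bᶜ) > 0` and `μ(Aᶜ ∩ B) > 0` admits a (strong) Reichenbachian
common cause `C ⊆ A ∩ B`. -/
theorem stmt12 {Ω : Type*} [MeasurableSpace Ω] (μ : Measure Ω) [IsProbabilityMeasure μ]
    (hatomless : ∀ A : Set Ω, MeasurableSet A → 0 < μ A →
      ∃ B : Set Ω, MeasurableSet B ∧ B ⊆ A ∧ 0 < μ B ∧ μ B < μ A)
    (A B : Set Ω) (hA : MeasurableSet A) (hB : MeasurableSet B)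
    (hcorr : (μ (A ∩ B)).toReal > (μ A).toReal * (μ B).toReal)
    (hABc : (μ (A ∩ Bᶜ)).toReal > 0)
    (hAcB : (μ (Aᶜ ∩ B)).toReal > 0) :
    ∃ C : Set Ω, MeasurableSet C ∧ C ⊆ A ∩ B ∧
      0 < (μ C).toReal ∧ (μ C).toReal < 1 ∧
      (μ (A ∩ B ∩ C)).toReal / (μ C).toReal =
        ((μ (A ∩ C)).toReal / (μ C).toReal) * ((μ (B ∩ C)).toReal / (μ C).toReal) ∧
      (μ (A ∩ B ∩ Cᶜ)).toReal / (μ Cᶜ).toReal =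
        ((μ (A ∩ Cᶜ)).toReal / (μ Cᶜ).toReal) * ((μ (B ∩ Cᶜ)).toReal / (μ Cᶜ).toReal) ∧
      (μ (A ∩ C)).toReal / (μ C).toReal > (μ (A ∩ Cᶜ)).toReal / (μ Cᶜ).toReal ∧
      (μ (B ∩ C)).toReal / (μ C).toReal > (μ (B ∩ Cᶜ)).toReal / (μ Cᶜ).toReal := by
  simp only [← measureReal_def] at *
  have hAsplit := measureReal_inter_add_sdiff (μ := μ) (s := A) hB
  have hBsplit := measureReal_inter_add_sdiff (μ := μ) (s := B) hA
  rw [Set.sdiff_eq] at hAsplit hBsplit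
  rw [Set.inter_comm B A, Set.inter_comm B Aᶜ] at hBsplit
  have hABm := hA.inter hB
  set p := μ.real (A ∩ B)
  set a := μ.real (A ∩ Bᶜ)
  set b := μ.real (Aᶜ ∩ B)
  rw [← hAsplit, ← hBsplit] at hcorr
  have hp : 0 ≤ p := measureReal_nonneg
  obtain ⟨d, hd⟩ : ∃ d, d = 1 - p - a - b := ⟨_, rfl⟩
  have hpd : a * b < p * d := by rw [hd]; linarith
  have hab : 0 < a * b := mul_pos hABc hAcB
  have hd0 : 0 < d := pos_of_mul_pos_right (hab.trans hpd) hp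
  have hq0 : 0 < a * b / d := div_pos hab hd0
  have hqp : a * b / d < p := (div_lt_iff₀ hd0).2 hpd
  have hqd : a * b / d * d = a * b := div_mul_cancel₀ _ hd0.ne'
  obtain ⟨C, hC, hCAB, hCp⟩ := Measure.exists_subset_measureReal_eq (μ := μ) hatomless hABm
    (t := p - a * b / d) (by linarith) (by linarith)
  have hCA : C ⊆ A := hCAB.trans Set.inter_subset_left
  have hCB : C ⊆ B := hCAB.trans Set.inter_subset_right
  have hABC := measureReal_sdiff hCAB hC (μ := μ)
  have hAC := measureReal_sdiff hCA hC (μ := μ)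
  have hBC := measureReal_sdiff hCB hC (μ := μ)
  rw [Set.sdiff_eq] at hABC hAC hBC
  have hC0 : 0 < μ.real C := by linarith
  have hC1 : 0 < 1 - μ.real C := by linarith
  refine ⟨C, hC, hCAB, hC0, by linarith, ?_⟩
  rw [Set.inter_eq_self_of_subset_right hCAB, Set.inter_eq_self_of_subset_right hCA,
    Set.inter_eq_self_of_subset_right hCB, hABC, hAC, hBC, probReal_compl_eq_one_sub hC,
    ← hAsplit, ← hBsplit, div_self hC0.ne']
  refine ⟨by norm_num, ?_, (div_lt_one hC1).2 (by linarith), (div_lt_one hC1).2 (by linarith)⟩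
  rw [div_mul_div_comm, div_eq_div_iff hC1.ne' (mul_pos hC1 hC1).ne', hCp]
  generalize a * b / d = q at *
  subst hd
  linear_combination (1 - (p - q)) * hqd
end

section
/- Let (Ω, 𝒜, μ) be a probability space and A, B, C ∈ 𝒜 with C ⊆ A ∩ B, 0 < μ(C) < 1 and μ(A ∪ B) < 1. Then the screening-off condition with respect to Cᶜ, namely μ(A∩B∩Cᶜ)/μ(Cᶜ) = (μ(A∩Cᶜ)/μ(Cᶜ))·(μ(B∩Cᶜ)/μ(Cᶜ)), holds if and only if μ(C)·(1 − μ(A ∪ B)) = μ(A ∩ B) − μ(A)μ(B). -/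
open MeasureTheory

/-- for `C ⊆ A ∩ B` with `0 < μ(C) < 1` and `μ(A ∪ B) < 1`, the screening-off
condition with respect to `Cᶜ` holds iff `μ(C)·(1 − μ(A ∪ B)) = μ(A ∩ B) − μ(A)μ(B)`. -/
theorem stmt13 {Ω : Type*} [MeasurableSpace Ω] (μ : Measure Ω) [IsProbabilityMeasure μ]
    (A B C : Set Ω) (hA : MeasurableSet A) (hB : MeasurableSet B) (hC : MeasurableSet C)
    (hCsub : C ⊆ A ∩ B)
    (hCpos : 0 < (μ C).toReal) (hClt : (μ C).toReal < 1)
    (hAB : (μ (A ∪ B)).toReal < 1) :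
    ((μ (A ∩ B ∩ Cᶜ)).toReal / (μ Cᶜ).toReal =
      ((μ (A ∩ Cᶜ)).toReal / (μ Cᶜ).toReal) * ((μ (B ∩ Cᶜ)).toReal / (μ Cᶜ).toReal)) ↔
    (μ C).toReal * (1 - (μ (A ∪ B)).toReal) =
      (μ (A ∩ B)).toReal - (μ A).toReal * (μ B).toReal := by
  simp only [← measureReal_def] at *
  have inter_compl : ∀ S : Set Ω, C ⊆ S → μ.real (S ∩ Cᶜ) = μ.real S - μ.real C := fun S hS => by
    rw [← Set.sdiff_eq, measureReal_sdiff hS hC]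
  have union := measureReal_union_add_inter (μ := μ) (s := A) hB
  have hne : 1 - μ.real C ≠ 0 := by linarith
  rw [inter_compl _ hCsub, inter_compl A (hCsub.trans Set.inter_subset_left),
    inter_compl B (hCsub.trans Set.inter_subset_right), probReal_compl_eq_one_sub hC,
    div_mul_div_comm, div_eq_div_iff hne (mul_ne_zero hne hne), ← mul_assoc,
    mul_left_inj' hne]
  have union_eq : μ.real (A ∪ B) = μ.real A + μ.real B - μ.real (A ∩ B) := by linarith
  rw [union_eq]
  constructor <;> intro h <;> linarith
end
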